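/- Let E be a real Banach space, T > 0, 0 < α₀ < 1, r ≥ 1, N ≥ 2, and consider the graded mesh t_n = T(n/N)^r with step sizes τ_n = t_n − t_{n−1} and the associated Peano kernels K(s;θ). Let u : (0,T] → E be twice continuously differentiable with ‖u'(t)‖ ≤ C_u t^{α₀−1} and ‖u''(t)‖ ≤ C_u t^{α₀−2} for all t ∈ (0,T], and let k̃ : (0,T] → ℝ be measurable with |k̃(t)| ≤ C_k t^{−α₀}(1 + |ln t|). For 2 ≤ n ≤ N define (R₂)ⁿ = ∫_0^{t₁} k̃(t_n − s) ( ∫_{t₁}^{s} u'(θ) dθ ) ds + Σ_{j=2}^{n} ∫_{t_{j−1}}^{t_j} k̃(t_n − s) ( ∫_{t_{j−1}}^{t_j} K(s;θ) u''(θ) dθ ) ds. Then there exists C, depending only on r, α₀, T, C_u, C_k and not on N or n, such that ‖(R₂)ⁿ‖ ≤ C t_n^{−α₀} (1 + ln N) [ N^{−min{2, r(1+α₀)}} + Θ^N(α₀,r) ] for all 2 ≤ n ≤ N, where Θ^N(α₀,r) = N^{−2} if r(1+α₀) > 2, Θ^N(α₀,r) = N^{−2} ln N if r(1+α₀) = 2,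 and Θ^N(α₀,r) = N^{−r(1+α₀)} if r(1+α₀) < 2. -/

import Mathlib

open MeasureTheory intervalIntegral

/-- The graded temporal mesh `t_n = T (n/N)^r`. -/
noncomputable def gm (T r : ℝ) (N n : ℕ) : ℝ := T * ((n : ℝ) / (N : ℝ)) ^ r

/-- The Peano kernel of the midpoint-type interpolation quadrature on `[t_{j-1}, t_j]`. -/
noncomputable def peanoK (T r : ℝ) (N j : ℕ) (s θ : ℝ) : ℝ :=
  if θ ≤ s then
    (θ - gm T r N (j - 1)) * (s - gm T r N j) / (gm T r N j - gm T r N (j - 1))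
  else
    (θ - gm T r N j) * (s - gm T r N (j - 1)) / (gm T r N j - gm T r N (j - 1))

/-- The quantity `Θ^N(α₀, r)` of the quadrature remainder estimate. -/
noncomputable def Theta (α₀ r : ℝ) (N : ℕ) : ℝ :=
  if 2 < r * (1 + α₀) then (N : ℝ) ^ (-2 : ℝ)
  else if r * (1 + α₀) = 2 then (N : ℝ) ^ (-2 : ℝ) * Real.log (N : ℝ)
  else (N : ℝ) ^ (-(r * (1 + α₀)))

section Mesh

variable {T r : ℝ} {N : ℕ}

lemma gm_zero (hr : r ≠ 0) : gm T r N 0 = 0 := by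
  simp [gm, Real.zero_rpow hr]

lemma gm_pos (hT : 0 < T) (hN : 0 < N) {j : ℕ} (hj : 0 < j) : 0 < gm T r N j := by
  unfold gm
  positivity

lemma gm_nonneg (hT : 0 ≤ T) (j : ℕ) : 0 ≤ gm T r N j := by
  unfold gm
  positivity

lemma gm_mono (hT : 0 ≤ T) (hr : 0 ≤ r) : Monotone (gm T r N) := by
  intro i j hij
  unfold gm
  gcongr

lemma gm_self (hN : 0 < N) : gm T r N N = T := by
  have : (N : ℝ) ≠ 0 := by positivity
  simp [gm, this]

lemma gm_le (hT : 0 ≤ T) (hr : 0 ≤ r) (hN : 0 < N) {j : ℕ} (hj : j ≤ N) : gm T r N j ≤ T :=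
  (gm_mono hT hr hj).trans_eq (gm_self hN)

lemma gm_eq_mul_div_rpow {i j : ℕ} (hj : 0 < j) :
    gm T r N i = gm T r N j * ((i : ℝ) / j) ^ r := by
  have : (j : ℝ) ≠ 0 := by positivity
  rw [gm, gm, mul_assoc, ← Real.mul_rpow (by positivity) (by positivity)]
  congr 2
  field_simp

lemma gm_sub_pred_le (hT : 0 ≤ T) (hr : 1 ≤ r) {j : ℕ} (hj : 0 < j) :
    gm T r N j - gm T r N (j - 1) ≤ r * gm T r N j / j := by
  have hj' : (0 : ℝ) < j := by positivity
  have hj1 : (1 : ℝ) ≤ j := by exact_mod_cast hj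
  have hb : 1 + r * (-(1 / j)) ≤ (1 + (-(1 / j : ℝ))) ^ r :=
    one_add_mul_self_le_rpow_one_add (by
      rw [neg_le_neg_iff, div_le_one hj']; exact hj1) hr
  have hc : ((j - 1 : ℕ) : ℝ) / j = 1 + (-(1 / j : ℝ)) := by
    rw [Nat.cast_sub hj]
    field_simp
    ring
  rw [gm_eq_mul_div_rpow (i := j - 1) hj, hc]
  calc gm T r N j - gm T r N j * (1 + (-(1 / j : ℝ))) ^ r
      ≤ gm T r N j - gm T r N j * (1 + r * (-(1 / j))) := by
        gcongr
        exact gm_nonneg hT j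
    _ = r * gm T r N j / j := by ring

lemma gm_le_two_rpow_mul_pred (hT : 0 ≤ T) (hr : 0 ≤ r) {j : ℕ} (hj : 2 ≤ j) :
    gm T r N j ≤ 2 ^ r * gm T r N (j - 1) := by
  have hj2 : (2 : ℝ) ≤ j := by exact_mod_cast hj
  rw [gm_eq_mul_div_rpow (i := j) (j := j - 1) (by omega), mul_comm]
  refine mul_le_mul_of_nonneg_right ?_ (gm_nonneg hT _)
  refine Real.rpow_le_rpow (by positivity) ?_ hr
  rw [Nat.cast_sub (by omega), div_le_iff₀ (by push_cast; linarith)]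
  push_cast
  linarith

lemma gm_le_half (hT : 0 ≤ T) (hr : 1 ≤ r) {j n : ℕ} (hn : 0 < n) (hjn : 2 * j ≤ n) :
    gm T r N j ≤ gm T r N n / 2 := by
  have hn' : (0 : ℝ) < n := by positivity
  have hx : (j : ℝ) / n ≤ 1 / 2 := by
    rw [div_le_div_iff₀ hn' two_pos]
    exact_mod_cast (by omega : j * 2 ≤ 1 * n)
  have hp : ((j : ℝ) / n) ^ r ≤ 1 / 2 :=
    (Real.rpow_le_self_of_le_one (by positivity) (by linarith) hr).trans hx
  rw [gm_eq_mul_div_rpow (i := j) hn]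
  nlinarith [gm_nonneg (T := T) (r := r) (N := N) hT n]

lemma gm_rpow (hT : 0 ≤ T) (j : ℕ) (c : ℝ) :
    gm T r N j ^ c = T ^ c * ((N : ℝ) ^ (-(r * c)) * (j : ℝ) ^ (r * c)) := by
  rw [gm, Real.mul_rpow hT (by positivity), ← Real.rpow_mul (by positivity),
    Real.div_rpow (by positivity) (by positivity), Real.rpow_neg (by positivity)]
  ring

lemma abs_log_gm_le (hT : 0 < T) (hr : 0 ≤ r) {j : ℕ} (hj : 0 < j) (hjN : j ≤ N) :
    |Real.log (gm T r N j)| ≤ |Real.log T| + r * Real.log N := by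
  have hj' : (1 : ℝ) ≤ j := by exact_mod_cast hj
  have hjN' : (j : ℝ) ≤ N := by exact_mod_cast hjN
  have h1 : Real.log j ≤ Real.log N := Real.log_le_log (by linarith) hjN'
  have h2 : 0 ≤ Real.log j := Real.log_nonneg hj'
  rw [gm, Real.log_mul hT.ne' (Real.rpow_pos_of_pos (by apply div_pos <;> linarith) _).ne',
    Real.log_rpow (by apply div_pos <;> linarith), Real.log_div (by linarith) (by linarith)]
  refine (abs_add_le _ _).trans ?_
  gcongr
  rw [abs_mul, abs_of_nonneg hr, abs_of_nonpos (by linarith)]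
  gcongr
  linarith

end Mesh

/-- On a cell of the mesh, the Peano kernel is bounded by the length of the cell. -/
lemma abs_peanoK_le {T r : ℝ} {N j : ℕ} {s θ : ℝ}
    (hs : s ∈ Set.Icc (gm T r N (j - 1)) (gm T r N j))
    (hθ : θ ∈ Set.Icc (gm T r N (j - 1)) (gm T r N j)) :
    |peanoK T r N j s θ| ≤ gm T r N j - gm T r N (j - 1) := by
  obtain ⟨hs1, hs2⟩ := hs
  obtain ⟨hθ1, hθ2⟩ := hθ
  set a := gm T r N (j - 1)
  set b := gm T r N j
  have key : ∀ x y : ℝ, |x| ≤ b - a → |y| ≤ b - a → |x * y / (b - a)| ≤ b - a := by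
    intro x y hx hy
    have hab : 0 ≤ b - a := by linarith
    rw [abs_div, abs_mul, abs_of_nonneg hab]
    exact div_le_of_le_mul₀ hab hab (by gcongr)
  unfold peanoK
  split_ifs <;> apply key <;> rw [abs_le] <;> constructor <;> linarith

/-- A weakly singular weight with a logarithmic factor is dominated by a slightly more singular
pure power. -/
lemma rpow_mul_one_add_abs_log_le {a x t : ℝ} (h1 : a < 1) (hx : 0 < x) (hxt : x ≤ t) :
    x ^ (-a) * (1 + |Real.log x|) ≤
      (1 + |Real.log t| + 2 / (1 - a)) * (t ^ ((1 - a) / 2) * x ^ (-((1 + a) / 2))) := by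
  have ht : 0 < t := hx.trans_le hxt
  set ε := (1 - a) / 2 with hε
  have hε0 : 0 < ε := by rw [hε]; linarith
  have hy : 1 ≤ t / x := (one_le_div hx).2 hxt
  have hye : 1 ≤ (t / x) ^ ε := Real.one_le_rpow hy hε0.le
  have hl : Real.log (t / x) ≤ (t / x) ^ ε / ε := Real.log_le_rpow_div (by positivity) hε0
  have hl0 : 0 ≤ Real.log (t / x) := Real.log_nonneg hy
  have habs : |Real.log x| ≤ |Real.log t| + (t / x) ^ ε / ε := by
    rw [Real.log_div ht.ne' hx.ne'] at hl hl0
    have := abs_sub_abs_le_abs_sub (Real.log x) (Real.log t)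
    rw [abs_sub_comm, abs_of_nonneg hl0] at this
    linarith
  have hmain : 1 + |Real.log x| ≤ (1 + |Real.log t| + 1 / ε) * (t / x) ^ ε := by
    have : |Real.log t| * 1 ≤ |Real.log t| * (t / x) ^ ε := by gcongr
    calc 1 + |Real.log x| ≤ 1 + (|Real.log t| * 1 + (t / x) ^ ε / ε) := by linarith
      _ ≤ (t / x) ^ ε + (|Real.log t| * (t / x) ^ ε + (t / x) ^ ε / ε) := by gcongr
      _ = _ := by ring
  have hpow : x ^ (-a) * (t / x) ^ ε = t ^ ε * x ^ (-((1 + a) / 2)) := by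
    rw [Real.div_rpow ht.le hx.le, show -((1 + a) / 2) = -a - ε by rw [hε]; ring,
      Real.rpow_sub hx]
    ring
  have h2 : 2 / (1 - a) = 1 / ε := by rw [hε]; field_simp
  calc x ^ (-a) * (1 + |Real.log x|)
      ≤ x ^ (-a) * ((1 + |Real.log t| + 1 / ε) * (t / x) ^ ε) := by gcongr
    _ = (1 + |Real.log t| + 1 / ε) * (x ^ (-a) * (t / x) ^ ε) := by ring
    _ = _ := by rw [hpow, h2]

lemma sum_Icc_rpow_sub_one_le {q : ℝ} (hq : 0 < q) (n : ℕ) :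
    ∑ j ∈ Finset.Icc 1 n, (j : ℝ) ^ (q - 1) ≤ (1 + 1 / q) * (n : ℝ) ^ q := by
  rcases le_total 1 q with h | h
  · rcases Nat.eq_zero_or_pos n with rfl | hn
    · simp [Real.zero_rpow hq.ne']
    have hn' : (0 : ℝ) < n := by positivity
    calc ∑ j ∈ Finset.Icc 1 n, (j : ℝ) ^ (q - 1)
        ≤ ∑ j ∈ Finset.Icc 1 n, (n : ℝ) ^ (q - 1) := by
          refine Finset.sum_le_sum fun j hj => ?_
          have : j ≤ n := (Finset.mem_Icc.1 hj).2
          exact Real.rpow_le_rpow (by positivity) (by exact_mod_cast this) (by linarith)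
      _ = (n : ℝ) ^ q := by
          simp only [Finset.sum_const, Nat.card_Icc, nsmul_eq_mul, Nat.add_sub_cancel]
          rw [Real.rpow_sub_one hn'.ne']
          field_simp
      _ ≤ _ := le_mul_of_one_le_left (by positivity) (by simp [hq.le])
  · have hsum : ∑ j ∈ Finset.Icc 1 n, (j : ℝ) ^ (q - 1) ≤ 1 / q * (n : ℝ) ^ q := by
      induction n with
      | zero => simp [Real.zero_rpow hq.ne']
      | succ n ih =>
        rw [Finset.sum_Icc_succ_top (by omega)]
        have hm : (0 : ℝ) < (n + 1 : ℕ) := by positivity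
        have hm1 : (1 : ℝ) ≤ (n + 1 : ℕ) := by simp
        have hb := rpow_one_add_le_one_add_mul_self (s := -(1 / ((n + 1 : ℕ) : ℝ)))
          (by rw [neg_le_neg_iff, div_le_one hm]; exact hm1) hq.le h
        have hn : (n : ℝ) = ((n + 1 : ℕ) : ℝ) * (1 + -(1 / ((n + 1 : ℕ) : ℝ))) := by
          field_simp
          push_cast
          ring
        have hnq : (n : ℝ) ^ q ≤ ((n + 1 : ℕ) : ℝ) ^ q - q * ((n + 1 : ℕ) : ℝ) ^ (q - 1) := by
          have h0 : 0 ≤ 1 + -(1 / ((n + 1 : ℕ) : ℝ)) := by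
            have : 1 / ((n + 1 : ℕ) : ℝ) ≤ 1 := (div_le_one hm).2 hm1
            linarith
          calc (n : ℝ) ^ q = ((n + 1 : ℕ) : ℝ) ^ q * (1 + -(1 / ((n + 1 : ℕ) : ℝ))) ^ q := by
                rw [← Real.mul_rpow hm.le h0, ← hn]
            _ ≤ ((n + 1 : ℕ) : ℝ) ^ q * (1 + q * -(1 / ((n + 1 : ℕ) : ℝ))) := by gcongr
            _ = _ := by rw [Real.rpow_sub_one hm.ne']; ring
        calc _ ≤ 1 / q * (n : ℝ) ^ q + ((n + 1 : ℕ) : ℝ) ^ (q - 1) := by gcongr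
          _ ≤ 1 / q * (((n + 1 : ℕ) : ℝ) ^ q - q * ((n + 1 : ℕ) : ℝ) ^ (q - 1))
              + ((n + 1 : ℕ) : ℝ) ^ (q - 1) := by gcongr
          _ = _ := by field_simp; ring
    refine hsum.trans ?_
    gcongr
    linarith

lemma Theta_nonneg (α₀ r : ℝ) {N : ℕ} (hN : 1 ≤ N) : 0 ≤ Theta α₀ r N := by
  have : 0 ≤ Real.log N := Real.log_nonneg (by exact_mod_cast hN)
  unfold Theta
  split_ifs <;> positivity

lemma exists_sum_rpow_le_Theta (α₀ r : ℝ) :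
    ∃ C > 0, ∀ n N : ℕ, 1 ≤ N → n ≤ N →
      (N : ℝ) ^ (-(r * (1 + α₀))) * ∑ j ∈ Finset.Icc 1 n, (j : ℝ) ^ (r * (1 + α₀) - 3) ≤
        C * ((N : ℝ) ^ (-(min 2 (r * (1 + α₀)))) + Theta α₀ r N) := by
  set p := r * (1 + α₀) with hp
  rcases lt_trichotomy p 2 with h | h | h
  · have hs : Summable fun n : ℕ => (n : ℝ) ^ (p - 3) :=
      Real.summable_nat_rpow.2 (by linarith)
    have hS : 0 ≤ ∑' n : ℕ, (n : ℝ) ^ (p - 3) := tsum_nonneg fun n => by positivity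
    refine ⟨∑' n : ℕ, (n : ℝ) ^ (p - 3) + 1, by linarith, fun n N hN _ => ?_⟩
    have hle : ∑ j ∈ Finset.Icc 1 n, (j : ℝ) ^ (p - 3) ≤ ∑' n : ℕ, (n : ℝ) ^ (p - 3) + 1 :=
      (hs.sum_le_tsum _ fun i _ => by positivity).trans (by linarith)
    have := Theta_nonneg α₀ r hN
    rw [min_eq_right h.le, mul_comm]
    gcongr
    linarith
  · refine ⟨1, one_pos, fun n N hN hn => ?_⟩
    rw [Theta, ← hp, if_neg (by linarith), if_pos h, h, min_self]
    have hsum : ∑ j ∈ Finset.Icc 1 n, (j : ℝ) ^ ((2 : ℝ) - 3) ≤ 1 + Real.log N := by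
      calc ∑ j ∈ Finset.Icc 1 n, (j : ℝ) ^ ((2 : ℝ) - 3)
          ≤ ∑ j ∈ Finset.Icc 1 N, (j : ℝ) ^ ((2 : ℝ) - 3) :=
            Finset.sum_le_sum_of_subset_of_nonneg (Finset.Icc_subset_Icc_right hn)
              fun _ _ _ => by positivity
        _ = (harmonic N : ℝ) := by
            rw [harmonic_eq_sum_Icc]
            push_cast
            refine Finset.sum_congr rfl fun j _ => ?_
            rw [← Real.rpow_neg_one]
            norm_num
        _ ≤ _ := harmonic_le_one_add_log N
    calc (N : ℝ) ^ (-2 : ℝ) * ∑ j ∈ Finset.Icc 1 n, (j : ℝ) ^ ((2 : ℝ) - 3)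
        ≤ (N : ℝ) ^ (-2 : ℝ) * (1 + Real.log N) := by gcongr
      _ = _ := by ring
  · have hq : 0 < p - 2 := by linarith
    refine ⟨1 + 1 / (p - 2), by positivity, fun n N hN hn => ?_⟩
    have hN' : (0 : ℝ) < N := by exact_mod_cast hN
    have hsum := sum_Icc_rpow_sub_one_le hq n
    rw [show p - 2 - 1 = p - 3 by ring] at hsum
    have := Theta_nonneg α₀ r hN
    rw [min_eq_left h.le]
    calc (N : ℝ) ^ (-p) * ∑ j ∈ Finset.Icc 1 n, (j : ℝ) ^ (p - 3)
        ≤ (N : ℝ) ^ (-p) * ((1 + 1 / (p - 2)) * (N : ℝ) ^ (p - 2)) := by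
          refine mul_le_mul_of_nonneg_left (hsum.trans ?_) (by positivity)
          gcongr
      _ = (1 + 1 / (p - 2)) * ((N : ℝ) ^ (-2 : ℝ) + 0) := by
          rw [add_zero, show (-2 : ℝ) = -p + (p - 2) by ring, Real.rpow_add hN']
          ring
      _ ≤ _ := by gcongr

lemma rpow_neg_mul_rpow_sub_two_le {p : ℝ} {n N : ℕ} (hn : 1 ≤ n) (hnN : n ≤ N) :
    (N : ℝ) ^ (-p) * (n : ℝ) ^ (p - 2) ≤ (N : ℝ) ^ (-(min 2 p)) := by
  have hn' : (1 : ℝ) ≤ n := by exact_mod_cast hn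
  have hnN' : (n : ℝ) ≤ N := by exact_mod_cast hnN
  rcases le_total 2 p with h | h
  · rw [min_eq_left h, show -(2 : ℝ) = -p + (p - 2) by ring, Real.rpow_add (by linarith)]
    gcongr
  · rw [min_eq_right h]
    exact mul_le_of_le_one_right (by positivity)
      (Real.rpow_le_one_of_one_le_of_nonpos hn' (by linarith))

lemma intervalIntegrable_sub_rpow_neg {b : ℝ} (hb : b < 1) (t x y : ℝ) :
    IntervalIntegrable (fun s => (t - s) ^ (-b)) volume x y := by
  simpa using (intervalIntegrable_rpow' (a := t - x) (b := t - y)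
    (by linarith : -1 < -b)).comp_sub_left t

lemma sum_integral_gm_sub_rpow_neg {T r b : ℝ} (hr : 0 < r) (hb : b < 1) (N n : ℕ) :
    ∑ j ∈ Finset.Icc 1 n, ∫ s in gm T r N (j - 1)..gm T r N j, (gm T r N n - s) ^ (-b) =
      gm T r N n ^ (1 - b) / (1 - b) := by
  have hsum := sum_integral_adjacent_intervals (μ := volume) (a := gm T r N) (n := n)
    (f := fun s => (gm T r N n - s) ^ (-b))
    fun k _ => intervalIntegrable_sub_rpow_neg hb _ _ _
  rw [gm_zero hr.ne', integral_comp_sub_left (fun x => x ^ (-b)),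
    integral_rpow (Or.inl (by linarith)), sub_self, sub_zero, Real.zero_rpow (by linarith),
    sub_zero, show -b + 1 = 1 - b by ring] at hsum
  rw [← hsum, Finset.range_eq_Ico]
  exact (Finset.sum_Ico_add' (fun j =>
    ∫ s in gm T r N (j - 1)..gm T r N j, (gm T r N n - s) ^ (-b)) 0 n 1).symm

/-- The kernel is bounded on a cell lying in the first half of `[0, t_n]`. -/
lemma integral_gm_sub_rpow_neg_le {T r b : ℝ} {N n j : ℕ} (hT : 0 < T) (hr : 1 ≤ r)
    (hb0 : 0 ≤ b) (hb : b < 1) (hN : 0 < N) (hj : 0 < j) (hjn : 2 * j ≤ n) :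
    ∫ s in gm T r N (j - 1)..gm T r N j, (gm T r N n - s) ^ (-b) ≤
      2 * r * gm T r N n ^ (-b) * (gm T r N j / j) := by
  have ht : 0 < gm T r N n := gm_pos hT hN (by omega)
  have hmono : gm T r N (j - 1) ≤ gm T r N j := gm_mono hT.le (by linarith) (by omega)
  have hhalf : gm T r N j ≤ gm T r N n / 2 := gm_le_half hT.le hr (by omega) hjn
  have h2 : (2 : ℝ) ^ b ≤ 2 := Real.rpow_le_self_of_one_le one_le_two hb.le
  have hpt : ∀ s ∈ Set.Icc (gm T r N (j - 1)) (gm T r N j),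
      (gm T r N n - s) ^ (-b) ≤ 2 * gm T r N n ^ (-b) := by
    intro s hs
    calc (gm T r N n - s) ^ (-b) ≤ (gm T r N n / 2) ^ (-b) :=
          Real.rpow_le_rpow_of_nonpos (by positivity) (by linarith [hs.2]) (by linarith)
      _ = 2 ^ b * gm T r N n ^ (-b) := by
          rw [Real.div_rpow ht.le zero_le_two, Real.rpow_neg zero_le_two, div_inv_eq_mul, mul_comm]
      _ ≤ _ := by gcongr
  calc ∫ s in gm T r N (j - 1)..gm T r N j, (gm T r N n - s) ^ (-b)
      ≤ ∫ _ in gm T r N (j - 1)..gm T r N j, 2 * gm T r N n ^ (-b) :=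
        integral_mono_on hmono (intervalIntegrable_sub_rpow_neg hb _ _ _) (by simp) hpt
    _ = 2 * gm T r N n ^ (-b) * (gm T r N j - gm T r N (j - 1)) := by
        rw [intervalIntegral.integral_const, smul_eq_mul, mul_comm]
    _ ≤ 2 * gm T r N n ^ (-b) * (r * gm T r N j / j) := by
        gcongr
        exact gm_sub_pred_le hT.le hr hj
    _ = _ := by ring

lemma exists_sum_cell_le {T a b r : ℝ} (hT : 0 < T) (ha : 0 ≤ a) (hr : 1 ≤ r)
    (hb0 : 0 ≤ b) (hb : b < 1) :
    ∃ C > 0, ∀ n N : ℕ, 1 ≤ n → n ≤ N →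
      ∑ j ∈ Finset.Icc 1 n, gm T r N j ^ a / (j : ℝ) ^ 2 *
          ∫ s in gm T r N (j - 1)..gm T r N j, (gm T r N n - s) ^ (-b) ≤
        C * gm T r N n ^ (-b) * ((N : ℝ) ^ (-(min 2 (r * (1 + a)))) + Theta a r N) := by
  obtain ⟨C₁, hC₁, hS⟩ := exists_sum_rpow_le_Theta a r
  have hb1 : 0 < 1 - b := by linarith
  refine ⟨2 * r * T ^ (1 + a) * C₁ + 4 * T ^ (1 + a) / (1 - b), by positivity,
    fun n N hn hnN => ?_⟩
  have hN : 0 < N := by omega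
  have hn' : (0 : ℝ) < n := by positivity
  have hΘ := Theta_nonneg a r (N := N) hN
  set p := r * (1 + a) with hp
  set P := (N : ℝ) ^ (-(min 2 p)) + Theta a r N with hP
  set t := gm T r N with ht_def
  have ht : 0 < t n := gm_pos hT hN hn
  set W : ℕ → ℝ := fun j => ∫ s in t (j - 1)..t j, (t n - s) ^ (-b) with hW
  have hW0 : ∀ j ≤ n, 0 ≤ W j := fun j hj =>
    integral_nonneg (gm_mono hT.le (by linarith) (by omega)) fun s hs =>
      Real.rpow_nonneg (sub_nonneg.2 (hs.2.trans (gm_mono hT.le (by linarith) hj))) _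
  have hcell : ∀ j ∈ Finset.Icc 1 n, t j ^ a / (j : ℝ) ^ 2 * W j ≤
      2 * r * t n ^ (-b) * (t j ^ (1 + a) * (j : ℝ) ^ (-3 : ℝ)) +
        4 * (t n ^ a / (n : ℝ) ^ 2) * W j := by
    intro j hj
    obtain ⟨hj1, hjn⟩ := Finset.mem_Icc.1 hj
    have hj' : (0 : ℝ) < j := by positivity
    have htj : 0 < t j := gm_pos hT hN hj1
    have hWj := hW0 j hjn
    rcases le_or_gt (2 * j) n with h | h
    · calc t j ^ a / (j : ℝ) ^ 2 * W j
          ≤ t j ^ a / (j : ℝ) ^ 2 * (2 * r * t n ^ (-b) * (t j / j)) := by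
            gcongr
            exact integral_gm_sub_rpow_neg_le hT hr hb0 hb hN hj1 h
        _ = 2 * r * t n ^ (-b) * (t j ^ (1 + a) * (j : ℝ) ^ (-3 : ℝ)) := by
            rw [Real.rpow_add htj, Real.rpow_one, Real.rpow_neg hj'.le,
              show (3 : ℝ) = (3 : ℕ) by norm_num, Real.rpow_natCast]
            field_simp
        _ ≤ _ := le_add_of_nonneg_right (by positivity)
    · have hjn2 : (n : ℝ) ≤ 2 * j := by exact_mod_cast h.le
      have hfrac : t j ^ a / (j : ℝ) ^ 2 ≤ 4 * (t n ^ a / (n : ℝ) ^ 2) := by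
        calc t j ^ a / (j : ℝ) ^ 2 ≤ t n ^ a / ((n : ℝ) / 2) ^ 2 := by
              gcongr
              · exact gm_mono hT.le (by linarith) hjn
              · linarith
          _ = _ := by field_simp; norm_num
      calc _ ≤ 4 * (t n ^ a / (n : ℝ) ^ 2) * W j := by gcongr
        _ ≤ _ := le_add_of_nonneg_left (by positivity)
  have hfar : ∑ j ∈ Finset.Icc 1 n, t j ^ (1 + a) * (j : ℝ) ^ (-3 : ℝ) ≤
      T ^ (1 + a) * (C₁ * P) := by
    calc ∑ j ∈ Finset.Icc 1 n, t j ^ (1 + a) * (j : ℝ) ^ (-3 : ℝ)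
        = T ^ (1 + a) * ((N : ℝ) ^ (-p) * ∑ j ∈ Finset.Icc 1 n, (j : ℝ) ^ (p - 3)) := by
          rw [Finset.mul_sum, Finset.mul_sum]
          refine Finset.sum_congr rfl fun j hj => ?_
          have hj' : (0 : ℝ) < j := by exact_mod_cast (Finset.mem_Icc.1 hj).1
          rw [ht_def, gm_rpow hT.le, ← hp, sub_eq_add_neg, Real.rpow_add hj']
          ring
      _ ≤ _ := by
          gcongr ?_ * ?_
          exact hS n N hN hnN
  have hnear : t n ^ a / (n : ℝ) ^ 2 * (t n ^ (1 - b) / (1 - b)) ≤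
      t n ^ (-b) * (T ^ (1 + a) / (1 - b) * P) := by
    calc t n ^ a / (n : ℝ) ^ 2 * (t n ^ (1 - b) / (1 - b))
        = t n ^ (-b) * (t n ^ (1 + a) * (n : ℝ) ^ (-2 : ℝ) / (1 - b)) := by
          rw [show 1 - b = 1 + -b by ring, Real.rpow_add ht, Real.rpow_add ht, Real.rpow_neg hn'.le]
          norm_cast
          field_simp
      _ = t n ^ (-b) * (T ^ (1 + a) / (1 - b) * ((N : ℝ) ^ (-p) * (n : ℝ) ^ (p - 2))) := by
          rw [ht_def, gm_rpow hT.le n (1 + a), ← hp, sub_eq_add_neg p, Real.rpow_add hn']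
          ring
      _ ≤ _ := by
          gcongr
          exact (rpow_neg_mul_rpow_sub_two_le hn hnN).trans (le_add_of_nonneg_right hΘ)
  calc ∑ j ∈ Finset.Icc 1 n, t j ^ a / (j : ℝ) ^ 2 * W j
      ≤ ∑ j ∈ Finset.Icc 1 n, (2 * r * t n ^ (-b) * (t j ^ (1 + a) * (j : ℝ) ^ (-3 : ℝ)) +
          4 * (t n ^ a / (n : ℝ) ^ 2) * W j) := Finset.sum_le_sum hcell
    _ = 2 * r * t n ^ (-b) * ∑ j ∈ Finset.Icc 1 n, t j ^ (1 + a) * (j : ℝ) ^ (-3 : ℝ) +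
          4 * (t n ^ a / (n : ℝ) ^ 2 * (t n ^ (1 - b) / (1 - b))) := by
        rw [Finset.sum_add_distrib, ← Finset.mul_sum, ← Finset.mul_sum, hW, ht_def,
          sum_integral_gm_sub_rpow_neg (by linarith) hb]
        ring
    _ ≤ 2 * r * t n ^ (-b) * (T ^ (1 + a) * (C₁ * P)) +
          4 * (t n ^ (-b) * (T ^ (1 + a) / (1 - b) * P)) := by gcongr
    _ = _ := by ring

section Remainder

variable {E : Type*} [NormedAddCommGroup E] [NormedSpace ℝ E]

lemma norm_integral_rpow_sub_one_le {v : ℝ → E} {C a s t : ℝ} (hC : 0 ≤ C) (ha : 0 < a)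
    (hs : 0 ≤ s) (hst : s ≤ t) (hv : ∀ θ ∈ Set.Ioc s t, ‖v θ‖ ≤ C * θ ^ (a - 1)) :
    ‖∫ θ in t..s, v θ‖ ≤ C / a * t ^ a := by
  rw [integral_symm, norm_neg]
  calc ‖∫ θ in s..t, v θ‖ ≤ ∫ θ in s..t, C * θ ^ (a - 1) :=
        norm_integral_le_of_norm_le hst (.of_forall hv)
          ((intervalIntegrable_rpow' (by linarith)).const_mul C)
    _ = C / a * (t ^ a - s ^ a) := by
        rw [intervalIntegral.integral_const_mul, integral_rpow (Or.inl (by linarith)),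
          sub_add_cancel]
        ring
    _ ≤ _ := by
        gcongr
        linarith [Real.rpow_nonneg hs a]

lemma norm_integral_peanoK_smul_le {T r a C s : ℝ} {N j : ℕ} {v : ℝ → E} (hT : 0 < T)
    (hr : 1 ≤ r) (ha : a ≤ 2) (hC : 0 ≤ C) (hN : 0 < N) (hj : 2 ≤ j)
    (hs : s ∈ Set.Icc (gm T r N (j - 1)) (gm T r N j))
    (hv : ∀ θ ∈ Set.Ioc (gm T r N (j - 1)) (gm T r N j), ‖v θ‖ ≤ C * θ ^ (a - 2)) :
    ‖∫ θ in gm T r N (j - 1)..gm T r N j, peanoK T r N j s θ • v θ‖ ≤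
      C * (r ^ 2 * (2 ^ r) ^ (2 - a)) * (gm T r N j ^ a / (j : ℝ) ^ 2) := by
  have hj' : (0 : ℝ) < j := by positivity
  have hmono : gm T r N (j - 1) ≤ gm T r N j := gm_mono hT.le (by linarith) (by omega)
  have hx : 0 < gm T r N (j - 1) := gm_pos hT hN (by omega)
  have hy : 0 < gm T r N j := gm_pos hT hN (by omega)
  have hτ0 : 0 ≤ gm T r N j - gm T r N (j - 1) := sub_nonneg.2 hmono
  have hτ := gm_sub_pred_le (N := N) hT.le hr (show 0 < j by omega)
  have hxy : gm T r N (j - 1) ^ (a - 2) ≤ (2 ^ r) ^ (2 - a) * gm T r N j ^ (a - 2) := by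
    have h2 := gm_le_two_rpow_mul_pred (N := N) hT.le (by linarith : 0 ≤ r) hj
    calc gm T r N (j - 1) ^ (a - 2) ≤ (gm T r N j / 2 ^ r) ^ (a - 2) :=
          Real.rpow_le_rpow_of_nonpos (by positivity)
            (by rw [div_le_iff₀' (by positivity)]; exact h2) (by linarith)
      _ = _ := by
          rw [Real.div_rpow hy.le (by positivity), show a - 2 = -(2 - a) by ring,
            Real.rpow_neg (x := (2 : ℝ) ^ r) (by positivity), div_inv_eq_mul, mul_comm]
  have hpt : ∀ θ ∈ Set.uIoc (gm T r N (j - 1)) (gm T r N j), ‖peanoK T r N j s θ • v θ‖ ≤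
      (r * gm T r N j / j) * (C * ((2 ^ r) ^ (2 - a) * gm T r N j ^ (a - 2))) := by
    intro θ hθ
    rw [Set.uIoc_of_le hmono] at hθ
    rw [norm_smul, Real.norm_eq_abs]
    have h1 := (abs_peanoK_le hs ⟨hθ.1.le, hθ.2⟩).trans hτ
    have h2 : θ ^ (a - 2) ≤ gm T r N (j - 1) ^ (a - 2) :=
      Real.rpow_le_rpow_of_nonpos hx hθ.1.le (by linarith)
    have h3 : ‖v θ‖ ≤ C * ((2 ^ r) ^ (2 - a) * gm T r N j ^ (a - 2)) :=
      (hv θ hθ).trans (by gcongr; exact h2.trans hxy)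
    gcongr
  refine (norm_integral_le_of_norm_le_const hpt).trans ?_
  rw [abs_of_nonneg hτ0]
  calc _ ≤ (r * gm T r N j / j) * (C * ((2 ^ r) ^ (2 - a) * gm T r N j ^ (a - 2))) *
        (r * gm T r N j / j) := by gcongr
    _ = _ := by
        rw [show a = a - 2 + 1 + 1 by ring, Real.rpow_add_one hy.ne' (a - 2 + 1),
          Real.rpow_add_one hy.ne' (a - 2), show a - 2 + 1 + 1 = a by ring]
        field_simp

lemma norm_integral_kernel_smul_le {k : ℝ → ℝ} {F : ℝ → E} {x y t b D A : ℝ} (hb : b < 1)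
    (hD : 0 ≤ D) (hx : 0 ≤ x) (hxy : x ≤ y) (hyt : y ≤ t)
    (hk : ∀ z ∈ Set.Ioc 0 t, |k z| ≤ D * z ^ (-b)) (hF : ∀ s ∈ Set.Ioc x y, ‖F s‖ ≤ A) :
    ‖∫ s in x..y, k (t - s) • F s‖ ≤ D * (A * ∫ s in x..y, (t - s) ^ (-b)) := by
  rw [← mul_assoc, ← intervalIntegral.integral_const_mul]
  refine norm_integral_le_of_norm_le hxy ?_
    ((intervalIntegrable_sub_rpow_neg hb _ _ _).const_mul _)
  filter_upwards [Measure.ae_ne volume t] with s hst hs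
  have hts : 0 < t - s := sub_pos.2 (lt_of_le_of_ne (hs.2.trans hyt) hst)
  have h1 := hk (t - s) ⟨hts, by linarith [hs.1]⟩
  have h2 := hF s hs
  rw [norm_smul, Real.norm_eq_abs]
  calc |k (t - s)| * ‖F s‖ ≤ (D * (t - s) ^ (-b)) * A := by gcongr
    _ = _ := by ring

end Remainder

theorem stmt_11 (T α₀ r Cu Ck : ℝ) (hT : 0 < T) (h0 : 0 < α₀) (h1 : α₀ < 1) (hr : 1 ≤ r) :
    ∃ C > 0, ∀ (E : Type) [NormedAddCommGroup E] [NormedSpace ℝ E] [CompleteSpace E],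
      ∀ N : ℕ, 2 ≤ N →
      ∀ (u u' u'' : ℝ → E) (k : ℝ → ℝ),
        (∀ s ∈ Set.Ioc (0:ℝ) T, HasDerivAt u (u' s) s) →
        (∀ s ∈ Set.Ioc (0:ℝ) T, HasDerivAt u' (u'' s) s) →
        ContinuousOn u'' (Set.Ioc 0 T) →
        (∀ s ∈ Set.Ioc (0:ℝ) T, ‖u' s‖ ≤ Cu * s ^ (α₀ - 1)) →
        (∀ s ∈ Set.Ioc (0:ℝ) T, ‖u'' s‖ ≤ Cu * s ^ (α₀ - 2)) →
        Measurable k →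
        (∀ s ∈ Set.Ioc (0:ℝ) T, |k s| ≤ Ck * s ^ (-α₀) * (1 + |Real.log s|)) →
        ∀ n : ℕ, 2 ≤ n → n ≤ N →
          ‖(∫ s in (0:ℝ)..gm T r N 1, k (gm T r N n - s) • (∫ θ in (gm T r N 1)..s, u' θ)) +
              ∑ j ∈ Finset.Icc 2 n,
                ∫ s in gm T r N (j - 1)..gm T r N j, k (gm T r N n - s) •
                  (∫ θ in gm T r N (j - 1)..gm T r N j, peanoK T r N j s θ • u'' θ)‖ ≤
            C * (gm T r N n) ^ (-α₀) * (1 + Real.log (N : ℝ)) *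
              ((N : ℝ) ^ (-(min 2 (r * (1 + α₀)))) + Theta α₀ r N) := by
  set b := (1 + α₀) / 2 with hb_def
  have hb0 : 0 ≤ b := by rw [hb_def]; linarith
  have hb : b < 1 := by rw [hb_def]; linarith
  have h1' : 0 < 1 - α₀ := by linarith
  obtain ⟨C₁, hC₁, hsum⟩ := exists_sum_cell_le hT h0.le hr hb0 hb
  set κ := 1 + |Real.log T| + r + 2 / (1 - α₀) with hκ
  have hκ0 : 0 < κ := by positivity
  set M := 1 / α₀ + r ^ 2 * (2 ^ r) ^ (2 - α₀) with hM
  have hM0 : 0 < M := by positivity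
  -- the absolute values keep the constant positive when one of the bounds vanishes
  refine ⟨(|Ck| + 1) * κ * ((|Cu| + 1) * M) * C₁, by positivity, ?_⟩
  intro E _ _ _ N hN u u' u'' k _ _ _ hu' hu'' _ hk n hn hnN
  have hN0 : 0 < N := by omega
  have hr0 : 0 ≤ r := by linarith
  have hCu : 0 ≤ Cu :=
    nonneg_of_mul_nonneg_left ((norm_nonneg _).trans (hu' T ⟨hT, le_rfl⟩)) (by positivity)
  have hCk : 0 ≤ Ck := by
    have := (abs_nonneg _).trans (hk T ⟨hT, le_rfl⟩)
    rw [mul_assoc] at this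
    exact nonneg_of_mul_nonneg_left this (by positivity)
  have hlogN : 0 ≤ Real.log N := Real.log_nonneg (by exact_mod_cast hN0)
  have hΘ := Theta_nonneg α₀ r (N := N) hN0
  set t := gm T r N with ht_def
  have ht : 0 < t n := gm_pos hT hN0 (by omega)
  have hmono : Monotone t := gm_mono hT.le hr0
  have htT : ∀ j ≤ n, t j ≤ T := fun j hj => gm_le hT.le hr0 hN0 (hj.trans hnN)
  have hlog : 1 + |Real.log (t n)| + 2 / (1 - α₀) ≤ κ * (1 + Real.log N) := by
    have hl : |Real.log (t n)| ≤ |Real.log T| + r * Real.log N :=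
      abs_log_gm_le hT hr0 (by omega) hnN
    have : 0 ≤ (1 + |Real.log T| + 2 / (1 - α₀)) * Real.log N := by positivity
    rw [hκ]
    linarith
  set D := Ck * (κ * (1 + Real.log N) * t n ^ ((1 - α₀) / 2)) with hD
  have hD0 : 0 ≤ D := by positivity
  have hkD : ∀ z ∈ Set.Ioc 0 (t n), |k z| ≤ D * z ^ (-b) := by
    intro z hz
    have hz0 := hz.1
    calc |k z| ≤ Ck * z ^ (-α₀) * (1 + |Real.log z|) := hk z ⟨hz.1, hz.2.trans (htT n le_rfl)⟩
      _ = Ck * (z ^ (-α₀) * (1 + |Real.log z|)) := by ring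
      _ ≤ Ck * (κ * (1 + Real.log N) * (t n ^ ((1 - α₀) / 2) * z ^ (-b))) := by
          refine mul_le_mul_of_nonneg_left ?_ hCk
          exact (rpow_mul_one_add_abs_log_le h1 hz.1 hz.2).trans (by gcongr)
      _ = _ := by ring
  have hinner {c : ℝ} {j : ℕ} (hj : j ∈ Finset.Icc 1 n) (hcM : c ≤ M) :
      Cu * c * (t j ^ α₀ / (j : ℝ) ^ 2) ≤ Cu * M * (t j ^ α₀ / (j : ℝ) ^ 2) := by
    have htj : 0 < t j := gm_pos hT hN0 (Finset.mem_Icc.1 hj).1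
    gcongr
  have hfirst : ‖∫ s in (0:ℝ)..t 1, k (t n - s) • (∫ θ in (t 1)..s, u' θ)‖ ≤
      D * (Cu * M * (t 1 ^ α₀ / ((1 : ℕ) : ℝ) ^ 2) *
        ∫ s in t (1 - 1)..t 1, (t n - s) ^ (-b)) := by
    have ht0 : t (1 - 1) = 0 := gm_zero (by linarith)
    rw [ht0]
    refine norm_integral_kernel_smul_le hb hD0 le_rfl (gm_nonneg hT.le 1)
      (hmono (by omega)) hkD fun s hs => ?_
    refine (norm_integral_rpow_sub_one_le hCu h0 hs.1.le hs.2 fun θ hθ =>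
      hu' θ ⟨hs.1.trans hθ.1, hθ.2.trans (htT 1 (by omega))⟩).trans ?_
    refine Eq.trans_le ?_ (hinner (c := 1 / α₀) (Finset.mem_Icc.2 ⟨le_rfl, by omega⟩)
      (le_add_of_nonneg_right (by positivity)))
    rw [Nat.cast_one]
    ring
  have hrest : ∀ j ∈ Finset.Ioc 1 n,
      ‖∫ s in t (j - 1)..t j, k (t n - s) • (∫ θ in t (j - 1)..t j, peanoK T r N j s θ • u'' θ)‖ ≤
      D * (Cu * M * (t j ^ α₀ / (j : ℝ) ^ 2) * ∫ s in t (j - 1)..t j, (t n - s) ^ (-b)) := by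
    intro j hj
    obtain ⟨hj1, hjn⟩ := Finset.mem_Ioc.1 hj
    refine norm_integral_kernel_smul_le hb hD0 (gm_nonneg hT.le _) (hmono (by omega))
      (hmono hjn) hkD fun s hs => ?_
    refine (norm_integral_peanoK_smul_le hT hr (by linarith) hCu hN0 hj1 ⟨hs.1.le, hs.2⟩
      fun θ hθ => hu'' θ ⟨(gm_nonneg hT.le _).trans_lt hθ.1, hθ.2.trans (htT j hjn)⟩).trans ?_
    exact hinner (Finset.mem_Icc.2 ⟨hj1.le, hjn⟩) (le_add_of_nonneg_left (by positivity))
  have hIcc : Finset.Icc 2 n = Finset.Ioc 1 n := by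
    ext j
    simp only [Finset.mem_Icc, Finset.mem_Ioc]
    omega
  have hpow : t n ^ ((1 - α₀) / 2) * t n ^ (-b) = t n ^ (-α₀) := by
    rw [← Real.rpow_add ht, hb_def]
    congr 1
    ring
  set P := (N : ℝ) ^ (-(min 2 (r * (1 + α₀)))) + Theta α₀ r N with hP
  have hP0 : 0 ≤ P := by positivity
  rw [hIcc]
  calc _ ≤ _ := norm_add_le_of_le hfirst (norm_sum_le_of_le _ hrest)
    _ = D * (Cu * M) * ∑ j ∈ Finset.Icc 1 n,
          t j ^ α₀ / (j : ℝ) ^ 2 * ∫ s in t (j - 1)..t j, (t n - s) ^ (-b) := by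
        rw [Finset.add_sum_Ioc_eq_sum_Icc (f := fun j : ℕ => D * (Cu * M *
          (t j ^ α₀ / (j : ℝ) ^ 2) * ∫ s in t (j - 1)..t j, (t n - s) ^ (-b))) (by omega),
          Finset.mul_sum]
        exact Finset.sum_congr rfl fun j _ => by ring
    _ ≤ D * (Cu * M) * (C₁ * t n ^ (-b) * P) := by
        gcongr
        exact hsum n N (by omega) hnN
    _ = Ck * κ * (Cu * M) * C₁ * (t n ^ ((1 - α₀) / 2) * t n ^ (-b)) * (1 + Real.log N) * P := by
        rw [hD]
        ring
    _ ≤ _ := by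
        rw [hpow]
        have hCk' : Ck ≤ |Ck| + 1 := (le_abs_self _).trans (by linarith)
        have hCu' : Cu ≤ |Cu| + 1 := (le_abs_self _).trans (by linarith)
        gcongr
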